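/- arXiv:1509.03282 — 8 statements merged into one kernel-verified Lean document; each statement's English description precedes it below -/
import Mathlib

section
/- Let (D, ω) be a finite weighted digraph and let L = v₁v₂…vₙ be a weighted median order of (D, ω). Then L satisfies the feedback property: for all 1 ≤ i ≤ j ≤ n, ω(N⁺_{D[i,j]}(vᵢ)) ≥ ω(N⁻_{D[i,j]}(vᵢ)) and ω(N⁻_{D[i,j]}(vⱼ)) ≥ ω(N⁺_{D[i,j]}(vⱼ)), where D[i,j] denotes the subdigraph of D induced on the interval [i,j] = {vᵢ, vᵢ₊₁, …, vⱼ}. -/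
variable {V : Type*}

/-- Out-neighborhood of `v`. -/
def Nplus (E : V → V → Prop) (v : V) : Set V := {w | E v w}

/-- In-neighborhood of `v`. -/
def Nminus (E : V → V → Prop) (v : V) : Set V := {w | E w v}

/-- Second out-neighborhood: vertices at directed distance exactly 2 from `v`. -/
def Npp (E : V → V → Prop) (v : V) : Set V :=
  {w | w ≠ v ∧ ¬ E v w ∧ ∃ u, E v u ∧ E u w}

/-- Weight of a set of vertices. -/
noncomputable def wt (ω : V → ℝ) (S : Set V) : ℝ := ∑ᶠ x ∈ S, ω x

/-- Total weight of the forward arcs of the ordering `L`. -/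
noncomputable def fwdW {n : ℕ} (E : V → V → Prop) (ω : V → ℝ) (L : Fin n ≃ V) : ℝ :=
  ∑ᶠ p ∈ {p : Fin n × Fin n | p.1 < p.2 ∧ E (L p.1) (L p.2)}, ω (L p.1) * ω (L p.2)

/-- `L` is a weighted median order of `(E, ω)`. -/
def IsWMedian {n : ℕ} (E : V → V → Prop) (ω : V → ℝ) (L : Fin n ≃ V) : Prop :=
  ∀ L' : Fin n ≃ V, fwdW E ω L' ≤ fwdW E ω L

/-- Number of forward arcs of the ordering `L`. -/
noncomputable def fwdCount {n : ℕ} (E : V → V → Prop) (L : Fin n ≃ V) : ℕ :=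
  Set.ncard {p : Fin n × Fin n | p.1 < p.2 ∧ E (L p.1) (L p.2)}

/-- `L` is a (unweighted) median order of `E`. -/
def IsMedian {n : ℕ} (E : V → V → Prop) (L : Fin n ≃ V) : Prop :=
  ∀ L' : Fin n ≃ V, fwdCount E L' ≤ fwdCount E L

/-- `K` is an interval of the digraph `E`. -/
def IsInterval (E : V → V → Prop) (K : Set V) : Prop :=
  ∀ u ∈ K, ∀ v ∈ K,
    Nplus E u \ K = Nplus E v \ K ∧ Nminus E u \ K = Nminus E v \ K

/-- `K` occurs as a set of consecutive vertices of the ordering `L`. -/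
def OrderConvex {n : ℕ} (L : Fin n ≃ V) (K : Set V) : Prop :=
  ∀ i j k : Fin n, i ≤ j → j ≤ k → L i ∈ K → L k ∈ K → L j ∈ K

/-- `{x, y}` is a missing edge. -/
def IsMissing (E : V → V → Prop) (x y : V) : Prop := x ≠ y ∧ ¬ E x y ∧ ¬ E y x

/-- The unordered pair `e` is a missing edge. -/
def IsMissingS (E : V → V → Prop) (e : Sym2 V) : Prop :=
  ∃ x y, e = s(x, y) ∧ IsMissing E x y

/-- The labelled losing relation: the missing edge `x₁y₁` loses to the missing edge `x₂y₂`
with this labelling of the endpoints. -/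
def LosesLab (E : V → V → Prop) (x1 y1 x2 y2 : V) : Prop :=
  IsMissing E x1 y1 ∧ IsMissing E x2 y2 ∧
  E x1 x2 ∧ y2 ∉ Nplus E x1 ∪ Npp E x1 ∧ E y1 y2 ∧ x2 ∉ Nplus E y1 ∪ Npp E y1

/-- The losing relation on missing edges: the arcs of the dependency digraph `Δ`. -/
def Loses (E : V → V → Prop) (e f : Sym2 V) : Prop :=
  ∃ x1 y1 x2 y2, e = s(x1, y1) ∧ f = s(x2, y2) ∧ LosesLab E x1 y1 x2 y2

/-- One merging step used to generate the sets `K(ξ)`. -/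
def MissTouch (E : V → V → Prop) (u v : V) : Prop :=
  IsMissing E u v ∨ ∃ e f : Sym2 V, Loses E e f ∧ u ∈ e ∧ v ∈ f

/-- `u` and `v` lie in the same set `K(ξ)` (or `u = v`). -/
def SameK (E : V → V → Prop) : V → V → Prop := Relation.EqvGen (MissTouch E)

/-- `J(f)`: equal to `{f}` when `f` is whole, and to `K(ξ)` for the unique connected
component `ξ` of the interval graph with `f ∈ K(ξ)` otherwise. -/
def Jset (E : V → V → Prop) (f : V) : Set V := {v | SameK E f v}

/-- A good digraph: all sets `K(ξ)` are intervals. -/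
def GoodDigraph (E : V → V → Prop) : Prop := ∀ f : V, IsInterval E (Jset E f)

/-- The set `G_L` of good vertices of the ordering `L`. -/
def GoodSet {n : ℕ} (E : V → V → Prop) (L : Fin (n + 1) ≃ V) : Set V :=
  {w | w ∉ Nplus E (L (Fin.last n)) ∧
    ∃ i j : Fin (n + 1), i ≤ j ∧ w = L j ∧ E (L (Fin.last n)) (L i) ∧ E (L i) w}

/-- The subdigraph of `E` induced on `K`. -/
def ERestrict (E : V → V → Prop) (K : Set V) : V → V → Prop :=
  fun x y => x ∈ K ∧ y ∈ K ∧ E x y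

/-- `(a, b)` is a convenient orientation of the missing edge `ab`. -/
def ConvenientFor (E : V → V → Prop) (a b : V) : Prop :=
  ∀ v, v ≠ a → v ≠ b → E v a → b ∈ Nplus E v ∪ Npp E v

/-- Two missing edges lie in the same connected component of the dependency digraph. -/
def DeltaConn (E : V → V → Prop) : Sym2 V → Sym2 V → Prop :=
  Relation.ReflTransGen (fun e f => Loses E e f ∨ Loses E f e)

/-- The connected component of `e` in the dependency digraph is a (maximal directed) path,
i.e. it contains a missing edge of in-degree zero. -/
def InPathComp (E : V → V → Prop) (e : Sym2 V) : Prop :=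
  ∃ f, IsMissingS E f ∧ DeltaConn E e f ∧ ¬ ∃ g, Loses E g f

open Classical in
theorem fwdW_perm_aux {V : Type*} {n : ℕ} (E : V → V → Prop) (ω : V → ℝ) (L : Fin n ≃ V)
    (σ : Equiv.Perm (Fin n)) :
    fwdW E ω (σ.symm.trans L) =
      ∑ a, ∑ b, if σ a < σ b ∧ E (L a) (L b) then ω (L a) * ω (L b) else 0 := by
  unfold fwdW
  rw [finsum_mem_eq_finite_toFinset_sum _ (Set.toFinite _), ← Fintype.sum_prod_type',
    ← Finset.sum_filter]
  symm
  refine Finset.sum_bij (fun p _ => (σ p.1, σ p.2)) ?_ ?_ ?_ ?_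
  · intro p hp; simpa using hp
  · rintro ⟨a, b⟩ _ ⟨c, d⟩ _ h; simpa using h
  · rintro ⟨a, b⟩ h; exact ⟨(σ.symm a, σ.symm b), by simpa using h, by simp⟩
  · intro p hp; simp

open Classical in
theorem wt_aux {V : Type*} {n : ℕ} (ω : V → ℝ) (L : Fin n ≃ V) (S : Set V) :
    wt ω S = ∑ b, if L b ∈ S then ω (L b) else 0 := by
  unfold wt
  have : Finite V := Finite.of_equiv _ L
  rw [finsum_mem_eq_finite_toFinset_sum _ (Set.toFinite _), ← Finset.sum_filter]
  symm
  refine Finset.sum_bij (fun p _ => L p) ?_ ?_ ?_ ?_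
  · intro p hp; simpa using hp
  · intro a _ c _ h; simpa using h
  · intro a h; exact ⟨L.symm a, by simpa using h, by simp⟩
  · intro p hp; simp

open Classical in
/-- Key comparison: `σ` moves the vertex at position `m` past the positions satisfying `P`. -/
theorem key_aux {V : Type*} {n : ℕ} (E : V → V → Prop) (ω : V → ℝ) (hω : ∀ v, 0 < ω v)
    (L : Fin n ≃ V) (hL : IsWMedian E ω L) (σ : Equiv.Perm (Fin n)) (m : Fin n)
    (P : Fin n → Prop) (s : ℝ)
    (h : ∀ a b, ((if σ a < σ b then 1 else 0 : ℝ)) =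
      (if a < b then 1 else 0) - s * (if a = m then (if P b then 1 else 0) else 0)
        + s * (if b = m then (if P a then 1 else 0) else 0)) :
    s * (∑ a, if P a ∧ E (L a) (L m) then ω (L a) else 0) ≤
      s * (∑ a, if P a ∧ E (L m) (L a) then ω (L a) else 0) := by
  have h1 := hL (σ.symm.trans L)
  have e0 : ((1 : Equiv.Perm (Fin n)).symm.trans L) = L := by ext; rfl
  have h0 : fwdW E ω L =
      ∑ a, ∑ b, if a < b ∧ E (L a) (L b) then ω (L a) * ω (L b) else 0 := by
    have h0 := fwdW_perm_aux E ω L 1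
    rw [e0] at h0
    exact h0
  rw [fwdW_perm_aux, h0] at h1
  have h2 : ∀ a b, (if σ a < σ b ∧ E (L a) (L b) then ω (L a) * ω (L b) else 0) =
      (if a < b ∧ E (L a) (L b) then ω (L a) * ω (L b) else 0)
      - (if a = m then s * ω (L m) * (if P b ∧ E (L m) (L b) then ω (L b) else 0) else 0)
      + (if b = m then s * ω (L m) * (if P a ∧ E (L a) (L m) then ω (L a) else 0) else 0) := by
    intro a b
    have hab := h a b
    by_cases hE : E (L a) (L b)
    · have e1 : (if σ a < σ b ∧ E (L a) (L b) then ω (L a) * ω (L b) else 0) =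
          (if σ a < σ b then 1 else 0 : ℝ) * (ω (L a) * ω (L b)) := by simp [hE]
      have e2 : (if a < b ∧ E (L a) (L b) then ω (L a) * ω (L b) else 0) =
          (if a < b then 1 else 0 : ℝ) * (ω (L a) * ω (L b)) := by simp [hE]
      have e3 : (if a = m then s * ω (L m) * (if P b ∧ E (L m) (L b) then ω (L b) else 0) else 0)
          = (if a = m then (if P b then 1 else 0) else 0 : ℝ) * (s * (ω (L a) * ω (L b))) := by
        by_cases ha : a = m
        · subst ha; by_cases hP : P b <;> simp [hE, hP]; ring
        · simp [ha]
      have e4 : (if b = m then s * ω (L m) * (if P a ∧ E (L a) (L m) then ω (L a) else 0) else 0)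
          = (if b = m then (if P a then 1 else 0) else 0 : ℝ) * (s * (ω (L a) * ω (L b))) := by
        by_cases hb : b = m
        · subst hb; by_cases hP : P a <;> simp [hE, hP]; ring
        · simp [hb]
      rw [e1, e2, e3, e4, hab]; ring
    · have e3 : (if a = m then s * ω (L m) * (if P b ∧ E (L m) (L b) then ω (L b) else 0) else 0)
          = 0 := by
        by_cases ha : a = m
        · subst ha; simp [hE]
        · simp [ha]
      have e4 : (if b = m then s * ω (L m) * (if P a ∧ E (L a) (L m) then ω (L a) else 0) else 0)
          = 0 := by
        by_cases hb : b = m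
        · subst hb; simp [hE]
        · simp [hb]
      rw [e3, e4]; simp [hE]
  simp only [h2, Finset.sum_add_distrib, Finset.sum_sub_distrib] at h1
  rw [Finset.sum_comm (f := fun a b => if a = m then
    s * ω (L m) * (if P b ∧ E (L m) (L b) then ω (L b) else 0) else 0)] at h1
  simp only [Finset.sum_ite_eq', Finset.mem_univ, if_true,
    ← Finset.mul_sum] at h1
  refine le_of_mul_le_mul_left ?_ (hω (L m))
  nlinarith [h1]

/-- The cyclic shift of the positions `i, …, j` sending `j` to `i`. -/
def shiftAux {n : ℕ} (i j : Fin n) (hij : i ≤ j) : Equiv.Perm (Fin n) where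
  toFun k := if k = j then i else if h : i ≤ k ∧ k < j then ⟨k + 1, by omega⟩ else k
  invFun k := if k = i then j else if h : i < k ∧ k ≤ j then ⟨k - 1, by omega⟩ else k
  left_inv k := by grind
  right_inv k := by grind

theorem stmt_0 {V : Type*} [Fintype V] {n : ℕ}
    (E : V → V → Prop) (hloop : ∀ v, ¬ E v v)
    (ω : V → ℝ) (hω : ∀ v, 0 < ω v)
    (L : Fin n ≃ V) (hL : IsWMedian E ω L)
    (i j : Fin n) (hij : i ≤ j) :
    wt ω (Nminus (ERestrict E (L '' Set.Icc i j)) (L i))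
        ≤ wt ω (Nplus (ERestrict E (L '' Set.Icc i j)) (L i)) ∧
    wt ω (Nplus (ERestrict E (L '' Set.Icc i j)) (L j))
        ≤ wt ω (Nminus (ERestrict E (L '' Set.Icc i j)) (L j)) := by
  classical
  have hm : ∀ a, L a ∈ L '' Set.Icc i j ↔ i ≤ a ∧ a ≤ j := by
    intro a; simp
  have hi := (hm i).2 ⟨le_rfl, hij⟩
  have hj := (hm j).2 ⟨hij, le_rfl⟩
  simp only [wt_aux ω L, Nminus, Nplus, ERestrict, Set.mem_ofPred_eq, hi, hj, true_and]
  simp only [hm]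
  constructor
  · have := key_aux E ω hω L hL (shiftAux i j hij).symm i (fun a => i < a ∧ a ≤ j) 1 (by
      intro a b
      simp only [shiftAux, Equiv.coe_fn_symm_mk]
      grind)
    simp only [one_mul] at this
    have hne : ∀ a, (E (L a) (L i) → a ≠ i) ∧ (E (L i) (L a) → a ≠ i) := by
      intro a
      constructor <;> rintro h rfl <;> exact hloop _ h
    refine le_of_eq_of_le (Finset.sum_congr rfl fun a _ => ?_)
      (this.trans_eq (Finset.sum_congr rfl fun a _ => ?_))
    · have hn := hne a
      clear hm hi hj this
      split_ifs <;> grind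
    · have hn := hne a
      clear hm hi hj this
      split_ifs <;> grind
  · have := key_aux E ω hω L hL (shiftAux i j hij) j (fun a => i ≤ a ∧ a < j) (-1) (by
      intro a b
      simp only [shiftAux, Equiv.coe_fn_mk]
      grind)
    simp only [neg_mul, one_mul, neg_le_neg_iff] at this
    have hne : ∀ a, (E (L a) (L j) → a ≠ j) ∧ (E (L j) (L a) → a ≠ j) := by
      intro a
      constructor <;> rintro h rfl <;> exact hloop _ h
    refine le_of_eq_of_le (Finset.sum_congr rfl fun a _ => ?_)
      (this.trans_eq (Finset.sum_congr rfl fun a _ => ?_))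
    · have hn := hne a
      clear hm hi hj this
      split_ifs <;> grind
    · have hn := hne a
      clear hm hi hj this
      split_ifs <;> grind
end

section
/- Let (D, ω) be a finite weighted digraph, let L = v₁v₂…vₙ be a weighted median order of (D, ω), and let e = (vᵢ,vⱼ) with i > j be a backward arc of D with respect to L. Then L is also a weighted median order of the weighted digraph D' = D − (vᵢ,vⱼ) + (vⱼ,vᵢ) obtained by reversing the orientation of e. -/
variable {V : Type*}

open Classical in
theorem fwdW_eq_aux {V : Type*} {n : ℕ} (E : V → V → Prop) (ω : V → ℝ) (L : Fin n ≃ V) :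
    fwdW E ω L = ∑ p : Fin n × Fin n,
      if p.1 < p.2 ∧ E (L p.1) (L p.2) then ω (L p.1) * ω (L p.2) else 0 := by
  unfold fwdW
  rw [finsum_mem_def, finsum_eq_sum_of_fintype]
  refine Finset.sum_congr rfl fun p _ => ?_
  simp [Set.indicator_apply]

theorem fwdW_mono_aux {V : Type*} {n : ℕ} (E E' : V → V → Prop) (ω : V → ℝ)
    (hω : ∀ v, 0 < ω v) (L : Fin n ≃ V)
    (h : ∀ a b, a < b → E (L a) (L b) → E' (L a) (L b)) :
    fwdW E ω L ≤ fwdW E' ω L := by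
  rw [fwdW_eq_aux, fwdW_eq_aux]
  refine Finset.sum_le_sum fun p _ => ?_
  have hp := mul_pos (hω (L p.1)) (hω (L p.2))
  have := h p.1 p.2
  split_ifs <;> first | exact le_rfl | exact hp.le | (exfalso; tauto)

theorem fwdW_upper_aux {V : Type*} {n : ℕ} (E E' : V → V → Prop) (ω : V → ℝ)
    (hω : ∀ v, 0 < ω v) (L : Fin n ≃ V) (x y : V)
    (h : ∀ a b, a < b → E' (L a) (L b) → E (L a) (L b) ∨ (L a = x ∧ L b = y)) :
    fwdW E' ω L ≤ fwdW E ω L + ω x * ω y := by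
  classical
  have h1 : ω x * ω y = ∑ p : Fin n × Fin n,
      if p = (L.symm x, L.symm y) then ω x * ω y else 0 := by simp
  rw [fwdW_eq_aux, fwdW_eq_aux, h1, ← Finset.sum_add_distrib]
  refine Finset.sum_le_sum fun p _ => ?_
  have hp := mul_pos (hω (L p.1)) (hω (L p.2))
  have hq := mul_pos (hω x) (hω y)
  by_cases hE' : p.1 < p.2 ∧ E' (L p.1) (L p.2)
  · rcases h p.1 p.2 hE'.1 hE'.2 with h2 | ⟨h2, h3⟩
    · rw [if_pos hE', if_pos ⟨hE'.1, h2⟩]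
      split_ifs <;> linarith
    · have h4 : p = (L.symm x, L.symm y) := by
        ext1 <;> simp [← h2, ← h3]
      rw [if_pos hE', if_pos h4, h2, h3]
      rw [h2, h3] at hp
      split_ifs <;> linarith
  · rw [if_neg hE']
    split_ifs <;> linarith

theorem fwdW_lower_aux {V : Type*} {n : ℕ} (E E' : V → V → Prop) (ω : V → ℝ)
    (hω : ∀ v, 0 < ω v) (L : Fin n ≃ V) (i j : Fin n) (hji : j < i)
    (h : ∀ a b, a < b → E (L a) (L b) → E' (L a) (L b))
    (hE : ¬ E (L j) (L i)) (hE' : E' (L j) (L i)) :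
    fwdW E ω L + ω (L j) * ω (L i) ≤ fwdW E' ω L := by
  classical
  have h1 : ω (L j) * ω (L i) = ∑ p : Fin n × Fin n,
      if p = (j, i) then ω (L j) * ω (L i) else 0 := by simp
  rw [fwdW_eq_aux, fwdW_eq_aux, h1, ← Finset.sum_add_distrib]
  refine Finset.sum_le_sum fun p _ => ?_
  have hp := mul_pos (hω (L p.1)) (hω (L p.2))
  by_cases hq : p = (j, i)
  · subst hq
    simp [hE, hE', hji]
  · have := h p.1 p.2
    rw [if_neg hq, add_zero]
    split_ifs <;> first | exact le_rfl | exact hp.le | (exfalso; tauto)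

theorem stmt_1 {V : Type*} [Fintype V] {n : ℕ}
    (E : V → V → Prop) (hloop : ∀ v, ¬ E v v)
    (ω : V → ℝ) (hω : ∀ v, 0 < ω v)
    (L : Fin n ≃ V) (hL : IsWMedian E ω L)
    (i j : Fin n) (hji : j < i) (he : E (L i) (L j)) :
    IsWMedian (fun x y => (E x y ∧ ¬ (x = L i ∧ y = L j)) ∨ (x = L j ∧ y = L i)) ω L := by
  intro L'
  have hmono : ∀ a b, a < b → E (L a) (L b) →
      (E (L a) (L b) ∧ ¬ (L a = L i ∧ L b = L j)) ∨ (L a = L j ∧ L b = L i) := by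
    intro a b hab h
    refine Or.inl ⟨h, ?_⟩
    rintro ⟨h1, h2⟩
    rw [L.injective h1, L.injective h2] at hab
    exact absurd hab hji.asymm
  by_cases hd : E (L j) (L i)
  · refine le_trans (fwdW_mono_aux _ E ω hω L' ?_) ((hL L').trans (fwdW_mono_aux E _ ω hω L hmono))
    rintro a b _ (⟨h, _⟩ | ⟨h1, h2⟩)
    · exact h
    · rw [h1, h2]; exact hd
  · have hu := fwdW_upper_aux E
      (fun x y => (E x y ∧ ¬ (x = L i ∧ y = L j)) ∨ (x = L j ∧ y = L i)) ω hω L' (L j) (L i)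
      (by
        rintro a b _ (⟨h, _⟩ | h)
        · exact Or.inl h
        · exact Or.inr h)
    have hl := fwdW_lower_aux E
      (fun x y => (E x y ∧ ¬ (x = L i ∧ y = L j)) ∨ (x = L j ∧ y = L i)) ω hω L i j hji
      hmono hd (Or.inr ⟨rfl, rfl⟩)
    have := hL L'
    linarith
end

section
/- Let (D, ω) be a finite weighted digraph and let 𝓘 = {I₁, …, I_r} be a set of pairwise disjoint intervals of D. Then for every weighted median order L of (D, ω) there exists a weighted median order L' of (D, ω) such that L and L' have the same last vertex (feed vertex) and every member of 𝓘 occurs as a set of consecutive vertices in L'. -/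
variable {V : Type*}

open Classical in
lemma fwdW_eq {V : Type*} [Fintype V] {n : ℕ} (E : V → V → Prop) (ω : V → ℝ) (L : Fin n ≃ V) :
    fwdW E ω L = ∑ u : V, ∑ v : V,
      if L.symm u < L.symm v ∧ E u v then ω u * ω v else 0 := by
  unfold fwdW
  rw [← Finset.sum_product', Finset.univ_product_univ]
  rw [finsum_mem_def, finsum_eq_sum_of_fintype]
  refine Fintype.sum_equiv (L.prodCongr L) _ _ ?_
  rintro ⟨i, j⟩
  simp [Set.indicator_apply]

lemma exists_order {V : Type*} [Fintype V] {n : ℕ} (h : Fintype.card V = n) (key : V → ℕ)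
    (hk : Function.Injective key) :
    ∃ L : Fin n ≃ V, ∀ u v, L.symm u < L.symm v ↔ key u < key v := by
  let _ : LinearOrder V := LinearOrder.lift' key hk
  refine ⟨(Fintype.orderIsoFinOfCardEq V h).toEquiv, fun u v => ?_⟩
  exact (Fintype.orderIsoFinOfCardEq V h).symm.lt_iff_lt

/-- gather `K` at the position of `x`. -/
def GatherAt {V : Type*} {n : ℕ} (L : Fin n ≃ V) (K : Set V) (x : V) (M : Fin n ≃ V) : Prop :=
  ∀ u v, (M.symm u < M.symm v ↔
    ((u ∈ K ∧ v ∈ K ∧ L.symm u < L.symm v) ∨ (u ∉ K ∧ v ∉ K ∧ L.symm u < L.symm v) ∨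
     (u ∈ K ∧ v ∉ K ∧ L.symm x < L.symm v) ∨ (u ∉ K ∧ v ∈ K ∧ L.symm u < L.symm x)))

open Classical in
lemma exists_gather {V : Type*} [Fintype V] {n : ℕ} (L : Fin n ≃ V) (K : Set V) (x : V)
    (hx : x ∈ K) : ∃ M, GatherAt L K x M := by
  have hcard : Fintype.card V = n := by
    rw [← Fintype.card_congr L, Fintype.card_fin]
  have key : ∀ u v : V, ∀ (a b : ℕ), a < n → b < n → (a < b → n * a + n ≤ n * b) := by
    intro u v a b ha hb hab
    nlinarith
  let pos : V → ℕ := fun v => (L.symm v : ℕ)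
  have hpos : ∀ v, pos v < n := fun v => (L.symm v).2
  have hinj : ∀ u v, pos u = pos v → u = v := fun u v h => L.symm.injective (Fin.ext h)
  have hmul : ∀ u v : V, pos u < pos v → n * pos u + n ≤ n * pos v := fun u v h => by
    nlinarith
  have hmulE : ∀ u v : V, pos u = pos v → n * pos u = n * pos v := fun u v h => by
    rw [h]
  let k : V → ℕ := fun v => if v ∈ K then n * pos x + pos v else n * pos v
  have hk : ∀ u v, k u < k v ↔
    ((u ∈ K ∧ v ∈ K ∧ pos u < pos v) ∨ (u ∉ K ∧ v ∉ K ∧ pos u < pos v) ∨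
     (u ∈ K ∧ v ∉ K ∧ pos x < pos v) ∨ (u ∉ K ∧ v ∈ K ∧ pos u < pos x)) := by
    intro u v
    have h1 := hpos u
    have h2 := hpos v
    have h4 := hmul u v
    have h5 := hmul v u
    have h6 := hmul x v
    have h7 := hmul v x
    have h8 := hmul u x
    have h9 := hmul x u
    have e1 := hinj u v
    have e2 := hinj u x
    have e3 := hinj v x
    have e4 := hmulE u v
    by_cases hu : u ∈ K <;> by_cases hv : v ∈ K
    · simp [k, hu, hv]
    · have : v ≠ x := fun h => hv (h ▸ hx)
      simp only [k, hu, hv]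
      simp
      constructor
      · intro h
        by_contra hc
        have : pos v < pos x := by
          rcases lt_trichotomy (pos v) (pos x) with h | h | h
          · exact h
          · exact absurd (e3 h) this
          · exact absurd h hc
        have := h7 this
        omega
      · intro h
        have := h6 h
        omega
    · have : u ≠ x := fun h => hu (h ▸ hx)
      simp only [k, hu, hv]
      simp
      constructor
      · intro h
        by_contra hc
        have : pos x < pos u := by
          rcases lt_trichotomy (pos u) (pos x) with h | h | h
          · exact absurd h hc
          · exact absurd (e2 h) this
          · exact h
        have := h9 this
        omega
      · intro h
        have := h8 h
        omega
    · simp only [k, hu, hv]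
      simp
      constructor
      · intro h
        by_contra hc
        rcases lt_trichotomy (pos u) (pos v) with h | h | h
        · exact absurd h hc
        · have := e4 h; omega
        · have := h5 h; omega
      · intro h
        have := h4 h
        omega
  have hkinj : Function.Injective k := by
    intro u v huv
    have a1 := (hk u v).not.1 (by omega)
    have a2 := (hk v u).not.1 (by omega)
    have e1 := hinj u v
    have e2 := hinj u x
    have e3 := hinj v x
    by_contra hne
    grind
  obtain ⟨M, hM⟩ := exists_order hcard k hkinj
  exact ⟨M, fun u v => (hM u v).trans (hk u v)⟩

open Classical in
lemma gather_sum {V : Type*} [Fintype V] {n : ℕ} (E : V → V → Prop) (ω : V → ℝ)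
    (L : Fin n ≃ V) (K : Set V) (hK : IsInterval E K) (M : V → Fin n ≃ V)
    (hM : ∀ x ∈ K, GatherAt L K x (M x)) :
    ∑ x with x ∈ K, ω x * fwdW E ω (M x) = ∑ x with x ∈ K, ω x * fwdW E ω L := by
  have hout : ∀ u ∈ K, ∀ x ∈ K, ∀ v, v ∉ K → (E u v ↔ E x v) := by
    intro u hu x hx v hv
    have := Set.ext_iff.1 (hK u hu x hx).1 v
    simpa [Nplus, hv] using this
  have hin : ∀ u ∈ K, ∀ x ∈ K, ∀ v, v ∉ K → (E v u ↔ E v x) := by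
    intro u hu x hx v hv
    have := Set.ext_iff.1 (hK u hu x hx).2 v
    simpa [Nminus, hv] using this
  simp only [fwdW_eq, Finset.mul_sum]
  simp only [← Finset.sum_product']
  let σ : V × V × V → V × V × V := fun t =>
    if t.2.1 ∈ K ∧ t.2.2 ∉ K then ⟨t.2.1, t.1, t.2.2⟩
    else if t.2.1 ∉ K ∧ t.2.2 ∈ K then ⟨t.2.2, t.2.1, t.1⟩ else t
  refine Finset.sum_nbij' σ σ ?_ ?_ ?_ ?_ ?_
  · rintro ⟨x, u, v⟩ h
    simp at h
    simp only [σ]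
    split_ifs <;> simp_all
  · rintro ⟨x, u, v⟩ h
    simp at h
    simp only [σ]
    split_ifs <;> simp_all
  · rintro ⟨x, u, v⟩ h
    simp at h
    by_cases hu : u ∈ K <;> by_cases hv : v ∈ K <;> simp [σ, hu, hv, h]
  · rintro ⟨x, u, v⟩ h
    simp at h
    by_cases hu : u ∈ K <;> by_cases hv : v ∈ K <;> simp [σ, hu, hv, h]
  · rintro ⟨x, u, v⟩ h
    simp at h
    have h1 := hM x h u v
    by_cases hu : u ∈ K <;> by_cases hv : v ∈ K
    · simp [σ, hu, hv, h1]
    · simp [σ, hu, hv, h1, hout u hu x h v hv]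
      split_ifs <;> ring
    · simp [σ, hu, hv, h1, hin v hv x h u hu]
      split_ifs <;> ring
    · simp [σ, hu, hv, h1]

lemma gather_median {V : Type*} [Fintype V] {n : ℕ} (E : V → V → Prop) (ω : V → ℝ)
    (hω : ∀ v, 0 < ω v)
    (L : Fin n ≃ V) (hL : IsWMedian E ω L) (K : Set V) (hK : IsInterval E K) (x : V) (hx : x ∈ K) :
    ∃ M, GatherAt L K x M ∧ IsWMedian E ω M := by
  classical
  have : ∀ y, ∃ M, y ∈ K → GatherAt L K y M := fun y => by
    by_cases hy : y ∈ K
    · obtain ⟨M, hM⟩ := exists_gather L K y hy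
      exact ⟨M, fun _ => hM⟩
    · exact ⟨L, fun h => absurd h hy⟩
  choose M hM using this
  refine ⟨M x, hM x hx, ?_⟩
  have hs := gather_sum E ω L K hK M hM
  have := (Finset.sum_eq_sum_iff_of_le
    (fun y _ => mul_le_mul_of_nonneg_left (hL (M y)) (hω y).le)).1 hs x (by simpa using hx)
  have := mul_left_cancel₀ (hω x).ne' this
  intro L'
  rw [this]
  exact hL L'

lemma orderConvex_iff {V : Type*} {n : ℕ} (L : Fin n ≃ V) (K : Set V) :
    OrderConvex L K ↔ ∀ u v w, u ∈ K → w ∈ K → v ∉ K →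
      L.symm u < L.symm v → L.symm v < L.symm w → False := by
  constructor
  · intro h u v w hu hw hv h1 h2
    exact hv (by simpa using h _ _ _ h1.le h2.le (by simpa using hu) (by simpa using hw))
  · intro h i j k hij hjk hi hk
    by_contra hj
    have h1 : i ≠ j := by rintro rfl; exact hj hi
    have h2 : j ≠ k := by rintro rfl; exact hj hk
    exact h (L i) (L j) (L k) hi hk hj (by simpa using lt_of_le_of_ne hij h1)
      (by simpa using lt_of_le_of_ne hjk h2)

lemma gather_step {V : Type*} [Fintype V] {n : ℕ} (E : V → V → Prop) (ω : V → ℝ)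
    (hω : ∀ v, 0 < ω v)
    (L : Fin (n + 1) ≃ V) (hL : IsWMedian E ω L) (K : Set V) (hK : IsInterval E K) :
    ∃ M : Fin (n + 1) ≃ V, IsWMedian E ω M ∧ M (Fin.last n) = L (Fin.last n) ∧
      OrderConvex M K ∧ ∀ K' : Set V, Disjoint K' K → OrderConvex L K' → OrderConvex M K' := by
  rcases K.eq_empty_or_nonempty with rfl | hne
  · exact ⟨L, hL, rfl, fun i j k _ _ h => absurd h (by simp), fun _ _ h => h⟩
  obtain ⟨x, hx, hmax⟩ := Set.exists_max_image K L.symm (Set.toFinite K) hne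
  obtain ⟨M, hG, hMm⟩ := gather_median E ω hω L hL K hK x hx
  refine ⟨M, hMm, ?_, ?_, ?_⟩
  · rw [← Equiv.eq_symm_apply]
    symm
    by_contra hne'
    have hlt : M.symm (L (Fin.last n)) < Fin.last n := lt_of_le_of_ne (Fin.le_last _) hne'
    have h2 := (hG (L (Fin.last n)) (M (Fin.last n))).1 (by simpa using hlt)
    have l1 := Fin.le_last (L.symm (M (Fin.last n)))
    have l2 := Fin.le_last (L.symm x)
    have l3 := hmax (L (Fin.last n))
    simp only [Equiv.symm_apply_apply] at h2 l3
    rcases h2 with h | h | h | h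
    · exact absurd h.2.2 (not_lt.2 l1)
    · exact absurd h.2.2 (not_lt.2 l1)
    · exact absurd (lt_of_le_of_lt (l3 h.1) h.2.2) (not_lt.2 l1)
    · exact absurd h.2.2 (not_lt.2 l2)
  · rw [orderConvex_iff]
    intro u v w hu hw hv h1 h2
    rw [hG] at h1 h2
    simp [hu, hv, hw] at h1 h2
    exact lt_asymm h1 h2
  · intro K' hd hc
    rw [orderConvex_iff] at hc ⊢
    intro u v w hu hw hv h1 h2
    have hu' := Set.disjoint_left.1 hd hu
    have hw' := Set.disjoint_left.1 hd hw
    have hx' := Set.disjoint_right.1 hd hx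
    rw [hG] at h1 h2
    by_cases hvK : v ∈ K
    · simp [hu', hvK, hw'] at h1 h2
      exact hc u x w hu hw hx' h1 h2
    · simp [hu', hvK, hw'] at h1 h2
      exact hc u v w hu hw hv h1 h2

theorem stmt_2 {V : Type*} [Fintype V] {n r : ℕ}
    (E : V → V → Prop) (hloop : ∀ v, ¬ E v v)
    (ω : V → ℝ) (hω : ∀ v, 0 < ω v)
    (I : Fin r → Set V) (hI : ∀ t, IsInterval E (I t))
    (hdisj : ∀ s t, s ≠ t → Disjoint (I s) (I t))
    (L : Fin (n + 1) ≃ V) (hL : IsWMedian E ω L) :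
    ∃ L' : Fin (n + 1) ≃ V, IsWMedian E ω L' ∧
      L' (Fin.last n) = L (Fin.last n) ∧ ∀ t, OrderConvex L' (I t) := by
  classical
  have key : ∀ S : Finset (Fin r), ∃ L' : Fin (n + 1) ≃ V, IsWMedian E ω L' ∧
      L' (Fin.last n) = L (Fin.last n) ∧ ∀ t ∈ S, OrderConvex L' (I t) := by
    intro S
    induction S using Finset.induction_on with
    | empty => exact ⟨L, hL, rfl, by simp⟩
    | insert a S ha ih =>
      obtain ⟨L', h1, h2, h3⟩ := ih
      obtain ⟨M, m1, m2, m3, m4⟩ := gather_step E ω hω L' h1 (I a) (hI a)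
      refine ⟨M, m1, m2.trans h2, fun t ht => ?_⟩
      rcases Finset.mem_insert.1 ht with rfl | ht
      · exact m3
      · exact m4 _ (hdisj t a (fun h => ha (h ▸ ht))) (h3 t ht)
  obtain ⟨L', h1, h2, h3⟩ := key Finset.univ
  exact ⟨L', h1, h2, fun t => h3 t (Finset.mem_univ t)⟩
end

section
/- Let (T, ω) be a finite weighted tournament and let L be a weighted median order of (T, ω) with feed vertex f. Then ω(N⁺(f)) ≤ ω(G_L). In particular, f has the weighted SNP. -/
variable {V : Type*}

open Classical in
theorem wt_eq_sum {V : Type*} [Fintype V] {n : ℕ} (ω : V → ℝ) (L : Fin n ≃ V) (S : Set V) :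
    wt ω S = ∑ k, if L k ∈ S then ω (L k) else 0 := by
  unfold wt
  rw [finsum_mem_def, finsum_eq_sum_of_fintype, ← Equiv.sum_comp L]
  simp only [Set.indicator_apply]

open Classical in
theorem fwdW_eq_sum {V : Type*} {n : ℕ} (E : V → V → Prop) (ω : V → ℝ) (L : Fin n ≃ V)
    (σ : Equiv.Perm (Fin n)) :
    fwdW E ω (σ.symm.trans L) =
      ∑ p, ∑ q, if σ p < σ q ∧ E (L p) (L q) then ω (L p) * ω (L q) else 0 := by
  unfold fwdW
  rw [finsum_mem_def, finsum_eq_sum_of_fintype, ← Equiv.sum_comp (σ.prodCongr σ),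
    Fintype.sum_prod_type]
  simp only [Set.indicator_apply, Set.mem_ofPred_eq, Equiv.prodCongr_apply, Prod.map,
    Equiv.trans_apply, Equiv.symm_apply_apply]

theorem exists_cycle {n : ℕ} (a j : Fin (n + 1)) (h : a ≤ j) :
    ∃ σ : Equiv.Perm (Fin (n + 1)), ∀ k,
      (σ k).val = if k = j then a.val else if a ≤ k ∧ k < j then k.val + 1 else k.val := by
  refine ⟨Fin.cycleIcc a j, fun k => ?_⟩
  split_ifs with h1 h2
  · subst h1; rw [Fin.cycleIcc_of_last h]
  · rw [Fin.cycleIcc_of_ge_of_lt h2.1 h2.2]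
    exact Fin.val_add_one_of_lt (lt_of_lt_of_le h2.2 (Fin.le_last _))
  · rcases lt_or_ge k a with h3 | h3
    · rw [Fin.cycleIcc_of_lt h3]
    · rw [Fin.cycleIcc_of_gt]
      exact lt_of_le_of_ne (not_lt.1 fun h4 => h2 ⟨h3, h4⟩) (Ne.symm h1)

open Classical in
theorem feedback {V : Type*} {n : ℕ}
    (E : V → V → Prop) (hloop : ∀ v, ¬ E v v)
    (ω : V → ℝ) (hω : ∀ v, 0 < ω v)
    (L : Fin (n + 1) ≃ V) (hL : IsWMedian E ω L) (a j : Fin (n + 1)) (h : a ≤ j) :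
    (∑ k, if a ≤ k ∧ k < j ∧ E (L j) (L k) then ω (L k) else 0) ≤
      ∑ k, if a ≤ k ∧ k < j ∧ E (L k) (L j) then ω (L k) else 0 := by
  obtain ⟨σ, hσ⟩ := exists_cycle a j h
  have h1 := hL (σ.symm.trans L)
  have h2 : fwdW E ω L =
      ∑ p, ∑ q, if p < q ∧ E (L p) (L q) then ω (L p) * ω (L q) else 0 := by
    refine (fwdW_eq_sum E ω L (Equiv.refl (Fin (n + 1)))).trans ?_
    refine Finset.sum_congr rfl fun p _ => Finset.sum_congr rfl fun q _ => ?_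
    exact if_congr Iff.rfl rfl rfl
  rw [h2, fwdW_eq_sum] at h1
  have key : ∀ p q : Fin (n + 1),
      (if σ p < σ q ∧ E (L p) (L q) then ω (L p) * ω (L q) else 0) =
      (if p < q ∧ E (L p) (L q) then ω (L p) * ω (L q) else 0) +
      (if p = j then ω (L j) * (if a ≤ q ∧ q < j ∧ E (L j) (L q) then ω (L q) else 0) else 0) -
      (if q = j then ω (L j) * (if a ≤ p ∧ p < j ∧ E (L p) (L j) then ω (L p) else 0) else 0) := by
    intro p q
    have e1 := hσ p
    have e2 := hσ q
    by_cases hE : E (L p) (L q)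
    · have hpq : p ≠ q := by rintro rfl; exact hloop _ hE
      by_cases hp : p = j
      · subst hp
        have hq : q ≠ p := Ne.symm hpq
        simp only [hE, hq, and_true, if_true, if_false, sub_zero, Fin.lt_def, Fin.le_def] at *
        have : q.val ≠ p.val := fun h => hq (Fin.ext h)
        split_ifs at * <;> first | omega | simp
      · by_cases hq : q = j
        · subst hq
          have : q.val ≠ p.val := fun h => hpq (Fin.ext h.symm)
          simp only [hE, hp, and_true, if_true, if_false, add_zero, Fin.lt_def, Fin.le_def] at *
          split_ifs at * <;> first | omega | simp [mul_comm]
        · have h3 : q.val ≠ p.val := fun h => hpq (Fin.ext h.symm)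
          have h4 : p.val ≠ j.val := fun h => hp (Fin.ext h)
          have h5 : q.val ≠ j.val := fun h => hq (Fin.ext h)
          simp only [hE, hp, hq, and_true, if_false, add_zero, sub_zero, Fin.lt_def,
            Fin.le_def] at *
          split_ifs at * <;> first | omega | simp
    · have g1 : (if p = j then ω (L j) *
          (if a ≤ q ∧ q < j ∧ E (L j) (L q) then ω (L q) else 0) else 0) = 0 := by
        split_ifs with c1 c2
        · subst c1; exact absurd c2.2.2 hE
        · simp
        · rfl
      have g2 : (if q = j then ω (L j) *
          (if a ≤ p ∧ p < j ∧ E (L p) (L j) then ω (L p) else 0) else 0) = 0 := by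
        split_ifs with c1 c2
        · subst c1; exact absurd c2.2.2 hE
        · simp
        · rfl
      rw [g1, g2]; simp [hE]
  simp only [key, Finset.sum_sub_distrib, Finset.sum_add_distrib] at h1
  rw [Finset.sum_comm (f := fun p q => if p = j then ω (L j) * (if a ≤ q ∧ q < j ∧ E (L j) (L q) then ω (L q) else 0) else 0)] at h1
  simp only [Finset.sum_ite_eq', Finset.mem_univ, if_true, ← Finset.mul_sum] at h1
  have h3 := hω (L j)
  refine le_of_mul_le_mul_left ?_ h3
  linarith

open Classical in
theorem mainInd {V : Type*} {n : ℕ}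
    (E : V → V → Prop) (hloop : ∀ v, ¬ E v v) (hdigon : ∀ x y, ¬ (E x y ∧ E y x))
    (htour : ∀ x y : V, x ≠ y → E x y ∨ E y x)
    (ω : V → ℝ) (hω : ∀ v, 0 < ω v)
    (L : Fin (n + 1) ≃ V) (hL : IsWMedian E ω L) (m : ℕ) :
    ∀ a : ℕ, n + 1 ≤ a + m →
    (∑ k : Fin (n + 1), if a ≤ k.val ∧ E (L (Fin.last n)) (L k) then ω (L k) else 0) ≤
      ∑ k, if ¬ E (L (Fin.last n)) (L k) ∧
        (∃ i : Fin (n + 1), a ≤ i.val ∧ i ≤ k ∧ E (L (Fin.last n)) (L i) ∧ E (L i) (L k))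
        then ω (L k) else 0 := by
  induction m with
  | zero =>
    intro a ha
    apply Finset.sum_le_sum
    intro k _
    rw [if_neg (by rintro ⟨h, -⟩; have := k.isLt; omega)]
    split_ifs
    · exact (hω _).le
    · exact le_rfl
  | succ m ih =>
    intro a ha
    by_cases han : n + 1 ≤ a
    · exact ih a (by omega)
    push Not at han
    set G : ℕ → Fin (n + 1) → Prop := fun a k => ¬ E (L (Fin.last n)) (L k) ∧
        (∃ i : Fin (n + 1), a ≤ i.val ∧ i ≤ k ∧ E (L (Fin.last n)) (L i) ∧ E (L i) (L k)) with hG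
    change _ ≤ ∑ k, if G a k then ω (L k) else 0
    by_cases hbad : ∃ i : Fin (n + 1), a ≤ i.val ∧ E (L i) (L (Fin.last n)) ∧ ¬ G a i
    · obtain ⟨i, ⟨hai, hil, hGi⟩, hmin⟩ := WellFounded.has_min (wellFounded_lt (α := Fin (n + 1)))
        {i | a ≤ i.val ∧ E (L i) (L (Fin.last n)) ∧ ¬ G a i} hbad
      have hmin' : ∀ k, k < i → a ≤ k.val → E (L k) (L (Fin.last n)) → G a k := by
        intro k hk h1 h2
        by_contra h3
        exact hmin k ⟨h1, h2, h3⟩ hk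
      have hli : ¬ E (L (Fin.last n)) (L i) := fun h => hdigon _ _ ⟨h, hil⟩
      have noback : ∀ k, k ≤ i → a ≤ k.val → E (L (Fin.last n)) (L k) → ¬ E (L k) (L i) :=
        fun k h1 h2 h3 h4 => hGi ⟨hli, k, h2, h1, h3, h4⟩
      have hfb := feedback E hloop ω hω L hL ⟨a, han⟩ i hai
      have hI := ih (i.val + 1) (by omega)
      change _ ≤ ∑ k, if G (i.val + 1) k then ω (L k) else 0 at hI
      have s1 : (∑ k : Fin (n + 1), if a ≤ k.val ∧ E (L (Fin.last n)) (L k) then ω (L k) else 0) ≤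
          (∑ k, if ⟨a, han⟩ ≤ k ∧ k < i ∧ E (L i) (L k) then ω (L k) else 0) +
          (∑ k : Fin (n + 1), if i.val + 1 ≤ k.val ∧ E (L (Fin.last n)) (L k)
            then ω (L k) else 0) := by
        rw [← Finset.sum_add_distrib]
        apply Finset.sum_le_sum
        intro k _
        have hk := (hω (L k)).le
        by_cases hc : a ≤ k.val ∧ E (L (Fin.last n)) (L k)
        · rw [if_pos hc]
          rcases lt_trichotomy k i with h | h | h
          · have hne : L k ≠ L i := fun e => h.ne (L.injective e)
            have : E (L i) (L k) :=
              (htour _ _ hne).resolve_left (noback k h.le hc.1 hc.2)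
            rw [if_pos ⟨hc.1, h, this⟩]
            split_ifs <;> linarith
          · subst h; exact absurd hc.2 hli
          · rw [if_pos (c := i.val + 1 ≤ k.val ∧ _) ⟨h, hc.2⟩]
            split_ifs <;> linarith
        · rw [if_neg hc]
          split_ifs <;> linarith
      have s2 : (∑ k, if ⟨a, han⟩ ≤ k ∧ k < i ∧ E (L k) (L i) then ω (L k) else 0) +
          (∑ k, if G (i.val + 1) k then ω (L k) else 0) ≤
          ∑ k, if G a k then ω (L k) else 0 := by
        rw [← Finset.sum_add_distrib]
        apply Finset.sum_le_sum
        intro k _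
        have hk := (hω (L k)).le
        by_cases hc : ⟨a, han⟩ ≤ k ∧ k < i ∧ E (L k) (L i)
        · obtain ⟨h1, h2, h3⟩ := hc
          have hne : L k ≠ L (Fin.last n) := fun e =>
            (lt_of_lt_of_le h2 (Fin.le_last _)).ne (L.injective e)
          have hkl := (htour _ _ hne).resolve_right fun h => noback k h2.le h1 h h3
          have hng : ¬ G (i.val + 1) k := by
            rintro ⟨-, t, ht, htk, -⟩
            rw [Fin.le_def] at htk
            rw [Fin.lt_def] at h2
            omega
          rw [if_pos ⟨h1, h2, h3⟩, if_neg hng, if_pos (hmin' k h2 h1 hkl), add_zero]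
        · rw [if_neg hc, zero_add]
          by_cases hg : G (i.val + 1) k
          · have : G a k := by
              obtain ⟨h0, t, ht, h⟩ := hg
              exact ⟨h0, t, by omega, h⟩
            rw [if_pos hg, if_pos this]
          · rw [if_neg hg]; split_ifs <;> linarith
      linarith
    · push Not at hbad
      have hfb := feedback E hloop ω hω L hL ⟨a, han⟩ (Fin.last n) (Fin.le_last _)
      refine le_trans (le_trans (le_of_eq ?_) hfb) ?_
      · apply Finset.sum_congr rfl
        intro k _
        refine if_congr ⟨fun h => ⟨h.1, lt_of_le_of_ne (Fin.le_last _) ?_, h.2⟩,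
          fun h => ⟨h.1, h.2.2⟩⟩ rfl rfl
        rintro rfl
        exact hloop _ h.2
      · apply Finset.sum_le_sum
        intro k _
        have hk := (hω (L k)).le
        by_cases hc : ⟨a, han⟩ ≤ k ∧ k < Fin.last n ∧ E (L k) (L (Fin.last n))
        · rw [if_pos hc, if_pos (hbad k hc.1 hc.2.2)]
        · rw [if_neg hc]; split_ifs <;> linarith

theorem stmt_4 {V : Type*} [Fintype V] {n : ℕ}
    (E : V → V → Prop) (hloop : ∀ v, ¬ E v v) (hdigon : ∀ x y, ¬ (E x y ∧ E y x))
    (htour : ∀ x y : V, x ≠ y → E x y ∨ E y x)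
    (ω : V → ℝ) (hω : ∀ v, 0 < ω v)
    (L : Fin (n + 1) ≃ V) (hL : IsWMedian E ω L)
    (f : V) (hf : f = L (Fin.last n)) :
    wt ω (Nplus E f) ≤ wt ω (GoodSet E L) ∧ wt ω (Nplus E f) ≤ wt ω (Npp E f) := by
  classical
  have h1 : wt ω (Nplus E f) ≤ wt ω (GoodSet E L) := by
    have h := mainInd E hloop hdigon htour ω hω L hL (n + 1) 0 (by omega)
    rw [wt_eq_sum ω L, wt_eq_sum ω L]
    refine le_trans (le_of_eq ?_) (le_trans h (le_of_eq ?_))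
    · apply Finset.sum_congr rfl
      intro k _
      refine if_congr ?_ rfl rfl
      subst hf
      simp [Nplus]
    · apply Finset.sum_congr rfl
      intro k _
      refine if_congr ?_ rfl rfl
      constructor
      · rintro ⟨h0, i, -, h2, h3, h4⟩
        exact ⟨h0, i, k, h2, rfl, h3, h4⟩
      · rintro ⟨h0, i, j, h2, h3, h4, h5⟩
        obtain rfl := L.injective h3
        exact ⟨h0, i, Nat.zero_le _, h2, h4, h5⟩
  refine ⟨h1, h1.trans ?_⟩
  rw [wt_eq_sum ω L, wt_eq_sum ω L]
  apply Finset.sum_le_sum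
  intro k _
  have hk := (hω (L k)).le
  by_cases hc : L k ∈ GoodSet E L
  · have : L k ∈ Npp E f := by
      obtain ⟨h0, i, j, h2, h3, h4, h5⟩ := hc
      subst hf
      refine ⟨fun e => ?_, h0, L i, h4, h5⟩
      rw [e] at h5
      exact hdigon _ _ ⟨h4, h5⟩
    rw [if_pos hc, if_pos this]
  · rw [if_neg hc]; split_ifs <;> linarith
end

section
/- Let T be a finite tournament and let L be a median order of T with feed vertex f. Then |N⁺(f)| ≤ |G_L|. In particular, f has the second neighborhood property. -/
variable {V : Type*}

/-- Feedback property: moving the vertex at `b` to just before `a` does not help. -/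
theorem feedback_s5 {V : Type*} {m : ℕ} (E : V → V → Prop) (hdigon : ∀ x y, ¬ (E x y ∧ E y x))
    (L : Fin m ≃ V) (hL : IsMedian E L) (a b : Fin m) (hab : a ≤ b) :
    {x : Fin m | a ≤ x ∧ x < b ∧ E (L b) (L x)}.ncard ≤
      {x : Fin m | a ≤ x ∧ x < b ∧ E (L x) (L b)}.ncard := by
  classical
  let t : Fin m → Fin m := fun x =>
    if h : a ≤ x ∧ x < b then ⟨x.1 + 1, by have := h.2; have := b.2; omega⟩
    else if x = b then a else x
  have tval : ∀ x, (t x).1 = if a.1 ≤ x.1 ∧ x.1 < b.1 then x.1 + 1 else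
      if x.1 = b.1 then a.1 else x.1 := by
    intro x
    simp only [t, Fin.le_def, Fin.lt_def, Fin.ext_iff]
    split_ifs <;> rfl
  have hab' : a.1 ≤ b.1 := hab
  have tinj : Function.Injective t := by
    intro x y h
    have h1 := congrArg Fin.val h
    rw [tval, tval] at h1
    apply Fin.ext
    split_ifs at h1 <;> omega
  let τ : Fin m ≃ Fin m := Equiv.ofBijective t (Finite.injective_iff_bijective.mp tinj)
  have hτ : ∀ x, τ x = t x := fun x => rfl
  let A : Set (Fin m × Fin m) := {p | p.1 < p.2 ∧ E (L p.1) (L p.2)}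
  let B : Set (Fin m × Fin m) := {p | t p.1 < t p.2 ∧ E (L p.1) (L p.2)}
  let I : Set (Fin m × Fin m) :=
    Set.image (fun x => (x, b)) {x : Fin m | a ≤ x ∧ x < b ∧ E (L x) (L b)}
  let O : Set (Fin m × Fin m) :=
    Set.image (fun x => (b, x)) {x : Fin m | a ≤ x ∧ x < b ∧ E (L b) (L x)}
  have hBA : B.ncard ≤ A.ncard := by
    have := hL (τ.symm.trans L)
    unfold fwdCount at this
    refine le_trans (le_of_eq ?_) this
    refine Set.ncard_congr (fun p _ => (t p.1, t p.2)) ?_ ?_ ?_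
    · rintro p ⟨h1, h2⟩
      refine ⟨h1, ?_⟩
      simpa [← hτ] using h2
    · rintro p q _ _ h
      simp only [Prod.mk.injEq] at h
      exact Prod.ext (tinj h.1) (tinj h.2)
    · rintro ⟨x, y⟩ ⟨h1, h2⟩
      refine ⟨(τ.symm x, τ.symm y), ⟨?_, ?_⟩, ?_⟩
      · simpa [← hτ] using h1
      · simpa using h2
      · simp [← hτ]
  have hU : A ∪ O ⊆ B ∪ I := by
    rintro ⟨x, y⟩ (⟨h1, h2⟩ | ⟨z, ⟨h1, h2, h3⟩, h4⟩)
    · by_cases h : a ≤ x ∧ y = b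
      · obtain ⟨h, h0⟩ := h
        subst h0
        exact Or.inr ⟨x, ⟨h, h1, h2⟩, rfl⟩
      · refine Or.inl ⟨?_, h2⟩
        simp only [Fin.le_def, Fin.lt_def, Fin.ext_iff] at *
        rw [tval, tval]
        split_ifs <;> omega
    · simp only [Prod.mk.injEq] at h4
      obtain ⟨rfl, rfl⟩ := h4
      refine Or.inl ⟨?_, h3⟩
      simp only [Fin.le_def, Fin.lt_def] at *
      rw [tval, tval]
      split_ifs <;> omega
  have hd : Disjoint A O := by
    rw [Set.disjoint_left]
    rintro ⟨x, y⟩ ⟨h1, h2⟩ ⟨z, ⟨h3, h4, h5⟩, h6⟩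
    simp only [Prod.mk.injEq] at h6
    obtain ⟨rfl, rfl⟩ := h6
    exact absurd h1 (not_lt.mpr h4.le)
  have c1 := Set.ncard_le_ncard hU (Set.toFinite _)
  rw [Set.ncard_union_eq hd (Set.toFinite _) (Set.toFinite _)] at c1
  have c2 := Set.ncard_union_le B I
  have c3 : O.ncard = {x : Fin m | a ≤ x ∧ x < b ∧ E (L b) (L x)}.ncard :=
    Set.ncard_image_of_injective _ (fun x y h => (Prod.mk.inj h).2)
  have c4 : I.ncard = {x : Fin m | a ≤ x ∧ x < b ∧ E (L x) (L b)}.ncard :=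
    Set.ncard_image_of_injective _ (fun x y h => (Prod.mk.inj h).1)
  omega

/-- Good positions of the final segment starting at `k`. -/
def goodFrom {n : ℕ} (e : Fin (n + 1) → Fin (n + 1) → Prop) (k : ℕ) : Set (Fin (n + 1)) :=
  {j | ¬ e (Fin.last n) j ∧ ∃ i : Fin (n + 1), k ≤ i.1 ∧ i ≤ j ∧ e (Fin.last n) i ∧ e i j}

theorem main_aux {n : ℕ} (e : Fin (n + 1) → Fin (n + 1) → Prop)
    (hloop : ∀ x, ¬ e x x) (hdigon : ∀ x y, ¬ (e x y ∧ e y x))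
    (htour : ∀ x y, x ≠ y → e x y ∨ e y x)
    (hfb : ∀ a b : Fin (n + 1), a ≤ b → {x : Fin (n + 1) | a ≤ x ∧ x < b ∧ e b x}.ncard ≤
      {x : Fin (n + 1) | a ≤ x ∧ x < b ∧ e x b}.ncard) :
    ∀ d k : ℕ, n + 1 - k = d →
      {x : Fin (n + 1) | k ≤ x.1 ∧ e (Fin.last n) x}.ncard ≤ (goodFrom e k).ncard := by
  intro d
  induction d using Nat.strong_induction_on with
  | _ d ih =>
  intro k hk
  by_cases hkn : n < k
  · have : {x : Fin (n + 1) | k ≤ x.1 ∧ e (Fin.last n) x} = ∅ := by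
      ext x
      have := x.2
      simp only [Set.mem_ofPred_eq, Set.mem_empty_iff_false, iff_false]
      rintro ⟨h, _⟩
      omega
    rw [this]
    simp
  push Not at hkn
  let P : Fin (n + 1) → Prop := fun j => k ≤ j.1 ∧ ¬ e (Fin.last n) j ∧ j ∉ goodFrom e k
  have hP : P (Fin.last n) := by
    refine ⟨hkn, hloop _, ?_⟩
    rintro ⟨_, i, _, _, h1, h2⟩
    exact hdigon _ _ ⟨h1, h2⟩
  obtain ⟨b, hb, hmin⟩ := WellFounded.has_min (wellFounded_lt (α := Fin (n + 1))) {j | P j} ⟨_, hP⟩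
  obtain ⟨hb1, hb2, hb3⟩ := hb
  have hdom : ∀ x : Fin (n + 1), k ≤ x.1 → x ≤ b → e (Fin.last n) x → x < b ∧ e b x := by
    intro x hx hxb hex
    have hne : x ≠ b := by rintro rfl; exact hb2 hex
    refine ⟨lt_of_le_of_ne hxb hne, ?_⟩
    rcases htour x b hne with h | h
    · exact absurd ⟨hb2, x, hx, hxb, hex, h⟩ hb3
    · exact h
  let a : Fin (n + 1) := ⟨k, by omega⟩
  have hf := hfb a b hb1
  have ihh := ih (n + 1 - (b.1 + 1)) (by have := b.2; omega) (b.1 + 1) rfl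
  have s1 : {x : Fin (n + 1) | k ≤ x.1 ∧ e (Fin.last n) x} ⊆
      {x : Fin (n + 1) | a ≤ x ∧ x < b ∧ e b x} ∪
      {x : Fin (n + 1) | b.1 + 1 ≤ x.1 ∧ e (Fin.last n) x} := by
    rintro x ⟨h1, h2⟩
    by_cases h : x ≤ b
    · exact Or.inl ⟨h1, hdom x h1 h h2⟩
    · exact Or.inr ⟨not_le.mp h, h2⟩
  have s2 : {x : Fin (n + 1) | a ≤ x ∧ x < b ∧ e x b} ∪ goodFrom e (b.1 + 1) ⊆ goodFrom e k := by
    rintro x (⟨h1, h2, h3⟩ | ⟨h1, i, h2, h3⟩)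
    · by_contra hx
      refine hmin x ⟨h1, fun h => ?_, hx⟩ h2
      exact hdigon _ _ ⟨h3, (hdom x h1 h2.le h).2⟩
    · exact ⟨h1, i, by omega, h3⟩
  have hd : Disjoint {x : Fin (n + 1) | a ≤ x ∧ x < b ∧ e x b} (goodFrom e (b.1 + 1)) := by
    rw [Set.disjoint_left]
    rintro x ⟨h1, h2, h3⟩ ⟨_, i, h4, h5, _⟩
    simp only [Fin.le_def, Fin.lt_def] at *
    omega
  have c1 := Set.ncard_le_ncard s1 (Set.toFinite _)
  have c2 := Set.ncard_le_ncard s2 (Set.toFinite _)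
  rw [Set.ncard_union_eq hd (Set.toFinite _) (Set.toFinite _)] at c2
  have c3 := Set.ncard_union_le {x : Fin (n + 1) | a ≤ x ∧ x < b ∧ e b x}
    {x : Fin (n + 1) | b.1 + 1 ≤ x.1 ∧ e (Fin.last n) x}
  omega

theorem stmt_5 {V : Type*} [Fintype V] {n : ℕ}
    (E : V → V → Prop) (hloop : ∀ v, ¬ E v v) (hdigon : ∀ x y, ¬ (E x y ∧ E y x))
    (htour : ∀ x y : V, x ≠ y → E x y ∨ E y x)
    (L : Fin (n + 1) ≃ V) (hL : IsMedian E L)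
    (f : V) (hf : f = L (Fin.last n)) :
    (Nplus E f).ncard ≤ (GoodSet E L).ncard ∧ (Nplus E f).ncard ≤ (Npp E f).ncard := by
  have key : (Nplus E f).ncard ≤ (GoodSet E L).ncard := by
    have h := main_aux (fun x y => E (L x) (L y)) (fun x => hloop _) (fun x y => hdigon _ _)
      (fun x y h => htour _ _ (fun hh => h (L.injective hh)))
      (fun a b hab => feedback_s5 E hdigon L hL a b hab) _ 0 rfl
    have e1 : Nplus E f =
        Set.image L {x : Fin (n + 1) | 0 ≤ x.1 ∧ E (L (Fin.last n)) (L x)} := by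
      subst hf
      ext w
      constructor
      · intro hw
        exact ⟨L.symm w, ⟨Nat.zero_le _, by simpa [Nplus] using hw⟩, by simp⟩
      · rintro ⟨x, ⟨_, hx⟩, rfl⟩
        exact hx
    have e2 : GoodSet E L = Set.image L (goodFrom (fun x y => E (L x) (L y)) 0) := by
      ext w
      constructor
      · rintro ⟨h1, i, j, hij, rfl, h2, h3⟩
        exact ⟨j, ⟨h1, i, Nat.zero_le _, hij, h2, h3⟩, rfl⟩
      · rintro ⟨j, ⟨h1, i, _, hij, h2, h3⟩, rfl⟩
        exact ⟨h1, i, j, hij, rfl, h2, h3⟩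
    rw [e1, e2, Set.ncard_image_of_injective _ L.injective,
      Set.ncard_image_of_injective _ L.injective]
    exact h
  refine ⟨key, key.trans (Set.ncard_le_ncard ?_ (Set.toFinite _))⟩
  subst hf
  rintro w ⟨h1, i, j, _, _, h2, h3⟩
  refine ⟨?_, h1, _, h2, h3⟩
  rintro rfl
  exact hdigon _ _ ⟨h2, h3⟩
end

section
/- Let D be a finite oriented graph missing a matching and let Δ denote its dependency digraph. Then every vertex of Δ has out-degree at most one and in-degree at most one; consequently Δ is a vertex-disjoint union of directed paths and directed cycles. -/
variable {V : Type*}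

theorem losesLab_symm {V : Type*} {E : V → V → Prop} {x y a b : V}
    (h : LosesLab E x y a b) : LosesLab E y x b a := by
  obtain ⟨⟨h1, h2, h3⟩, ⟨h4, h5, h6⟩, h7, h8, h9, h10⟩ := h
  exact ⟨⟨h1.symm, h3, h2⟩, ⟨h4.symm, h6, h5⟩, h9, h10, h7, h8⟩

theorem losesLab_noPath {V : Type*} {E : V → V → Prop} {x y a b : V}
    (h : LosesLab E x y a b) : ¬ E x b ∧ ∀ u, E x u → ¬ E u b := by
  obtain ⟨⟨h1, h2, h3⟩, ⟨h4, h5, h6⟩, h7, h8, h9, h10⟩ := h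
  have hb : ¬ E x b := fun hh => h8 (Or.inl hh)
  refine ⟨hb, fun u hu hub => h8 (Or.inr ⟨?_, hb, u, hu, hub⟩)⟩
  rintro rfl
  exact h3 h9

theorem losesLab_out {V : Type*} {E : V → V → Prop}
    (hmatch : ∀ a b c, IsMissing E a b → IsMissing E a c → b = c) {x y a b c d : V}
    (h : LosesLab E x y a b) (k : LosesLab E x y c d) : s(a, b) = s(c, d) := by
  have p := (losesLab_noPath (losesLab_symm h)).2
  have q := (losesLab_noPath k).2
  obtain ⟨-, hab, hxa, -, hyb, -⟩ := h
  obtain ⟨-, hcd, hxc, -, hyd, -⟩ := k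
  have hdc : IsMissing E d c := ⟨hcd.1.symm, hcd.2.2, hcd.2.1⟩
  by_cases had : a = d
  · subst had
    rw [hmatch _ _ _ hab hdc, Sym2.eq_swap]
  · have m : IsMissing E a d := ⟨had, q a hxa, p d hyd⟩
    have hbd := hmatch _ _ _ hab m
    subst hbd
    rw [hmatch _ _ _ hdc ⟨m.1.symm, m.2.2, m.2.1⟩]

theorem losesLab_in {V : Type*} {E : V → V → Prop}
    (hmatch : ∀ a b c, IsMissing E a b → IsMissing E a c → b = c) {x y u v a b : V}
    (h : LosesLab E x y a b) (k : LosesLab E u v a b) : s(x, y) = s(u, v) := by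
  have p := losesLab_noPath h
  have q := losesLab_noPath (losesLab_symm k)
  obtain ⟨hxy, -, hxa, -, hyb, -⟩ := h
  obtain ⟨huv, -, hua, -, hvb, -⟩ := k
  have hvu : IsMissing E v u := ⟨huv.1.symm, huv.2.2, huv.2.1⟩
  have hne : x ≠ v := by
    rintro rfl
    exact p.1 hvb
  have m : IsMissing E x v := ⟨hne, fun e => p.2 v e hvb, fun e => q.2 x e hxa⟩
  have hyv := hmatch _ _ _ hxy m
  subst hyv
  rw [hmatch _ _ _ hvu ⟨m.1.symm, m.2.2, m.2.1⟩]

theorem stmt_8 {V : Type*} [Fintype V]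
    (E : V → V → Prop) (hloop : ∀ v, ¬ E v v) (hdigon : ∀ x y, ¬ (E x y ∧ E y x))
    (hmatch : ∀ a b c, IsMissing E a b → IsMissing E a c → b = c) :
    (∀ e f g : Sym2 V, Loses E e f → Loses E e g → f = g) ∧
    (∀ e f g : Sym2 V, Loses E f e → Loses E g e → f = g) := by
  constructor
  · rintro e f g ⟨x, y, a, b, he, rfl, h⟩ ⟨x', y', c, d, he', rfl, k⟩
    rw [he] at he'
    rcases Sym2.eq_iff.1 he' with ⟨rfl, rfl⟩ | ⟨rfl, rfl⟩
    · exact losesLab_out hmatch h k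
    · rw [losesLab_out hmatch h (losesLab_symm k), Sym2.eq_swap]
  · rintro e f g ⟨x, y, a, b, rfl, he, h⟩ ⟨u, v, c, d, rfl, he', k⟩
    rw [he] at he'
    rcases Sym2.eq_iff.1 he' with ⟨rfl, rfl⟩ | ⟨rfl, rfl⟩
    · exact losesLab_in hmatch h k
    · rw [losesLab_in hmatch h (losesLab_symm k), Sym2.eq_swap]
end

section
/- Let D be a finite oriented graph missing a matching and let C = a₁b₁, a₂b₂, …, a_kb_k be a directed cycle of its dependency digraph Δ, where aᵢbᵢ loses to a_{i+1}b_{i+1} with aᵢ→a_{i+1} and bᵢ→b_{i+1} for i = 1,…,k−1, and a_kb_k loses to a₁b₁. If k is odd then a_k→a₁, b₁ ∉ N⁺⁺(a_k)∪N⁺(a_k), b_k→b₁, and a₁ ∉ N⁺⁺(b_k)∪N⁺(b_k). If k is even then a_k→b₁, a₁ ∉ N⁺⁺(a_k)∪N⁺(a_k), b_k→a₁, and b₁ ∉ N⁺⁺(b_k)∪N⁺(b_k). -/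
variable {V : Type*}

theorem losesLab_swap {V : Type*} {E : V → V → Prop} {x1 y1 x2 y2 : V}
    (h : LosesLab E x1 y1 x2 y2) : LosesLab E y1 x1 y2 x2 := by
  obtain ⟨⟨h1, h2, h3⟩, ⟨h4, h5, h6⟩, h7, h8, h9, h10⟩ := h
  exact ⟨⟨h1.symm, h3, h2⟩, ⟨h4.symm, h6, h5⟩, h9, h10, h7, h8⟩

theorem losesLab_step {V : Type*} {E : V → V → Prop}
    (hmatch : ∀ a b c, IsMissing E a b → IsMissing E a c → b = c) {x1 y1 x2 y2 v : V}
    (h : LosesLab E x1 y1 x2 y2) (hv : E x1 v) (hne : v ≠ x2) : E y2 v := by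
  obtain ⟨⟨h1, h2, h3⟩, ⟨h4, h5, h6⟩, h7, h8, h9, h10⟩ := h
  have hn : ¬ E x1 y2 := fun h => h8 (Or.inl h)
  have hyx : y2 ≠ x1 := by rintro rfl; exact h3 h9
  have hvy : ¬ E v y2 := fun h => h8 (Or.inr ⟨hyx, hn, v, hv, h⟩)
  by_contra hc
  have hvne : y2 ≠ v := by rintro rfl; exact hn hv
  exact hne (hmatch y2 v x2 ⟨hvne, hc, hvy⟩ ⟨h4.symm, h6, h5⟩)

theorem losesLab_back {V : Type*} {E : V → V → Prop} (hloop : ∀ v, ¬ E v v)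
    (hmatch : ∀ a b c, IsMissing E a b → IsMissing E a c → b = c) {x1 y1 x2 y2 : V}
    (h : LosesLab E x1 y1 x2 y2) : E y2 x1 := by
  obtain ⟨⟨h1, h2, h3⟩, ⟨h4, h5, h6⟩, h7, h8, h9, h10⟩ := h
  have hn : ¬ E x1 y2 := fun h => h8 (Or.inl h)
  have hyx : x1 ≠ y2 := by rintro rfl; exact h3 h9
  by_contra hc
  have := hmatch x1 y2 y1 ⟨hyx, hn, hc⟩ ⟨h1, h2, h3⟩
  subst this
  exact hloop _ h9

/-- The closing arc cannot be inconsistent with the alternating labelling. -/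
theorem no_bad_close {V : Type*} {E : V → V → Prop} (hloop : ∀ v, ¬ E v v)
    (hmatch : ∀ a b c, IsMissing E a b → IsMissing E a c → b = c)
    (k : ℕ) (hk : 1 ≤ k) (c d : ℕ → V)
    (hmiss : ∀ i, 1 ≤ i → i ≤ k → IsMissing E (c i) (d i))
    (hpath : ∀ i, 1 ≤ i → i < k → LosesLab E (c i) (d i) (d (i + 1)) (c (i + 1)))
    (hinj : ∀ i j, 1 ≤ i → i ≤ k → 1 ≤ j → j ≤ k → s(c i, d i) = s(c j, d j) → i = j)
    (hclose : LosesLab E (c k) (d k) (d 1) (c 1)) : False := by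
  rcases Nat.eq_or_lt_of_le hk with h | h
  · subst h
    exact (hmiss 1 le_rfl le_rfl).2.1 hclose.2.2.1
  · have key : ∀ i, 2 ≤ i → i ≤ k → E (c i) (c 1) := by
      intro i hi
      induction i, hi using Nat.le_induction with
      | base => intro _; exact losesLab_back hloop hmatch (hpath 1 le_rfl h)
      | succ i hi ih =>
        intro hik
        refine losesLab_step hmatch (hpath i (by omega) (by omega)) (ih (by omega)) ?_
        intro he
        have m1 := hmiss 1 le_rfl hk
        have m2 := hmiss (i + 1) (by omega) hik
        have h2 : d 1 = c (i + 1) := by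
          refine hmatch (c 1) _ _ m1 ?_
          rw [he]
          exact ⟨m2.1.symm, m2.2.2, m2.2.1⟩
        have := hinj 1 (i + 1) le_rfl hk (by omega) hik (by rw [he, h2]; exact Sym2.eq_swap)
        omega
    exact hclose.2.2.2.1 (Or.inl (key k h le_rfl))

theorem stmt_9 {V : Type*} [Fintype V]
    (E : V → V → Prop) (hloop : ∀ v, ¬ E v v) (hdigon : ∀ x y, ¬ (E x y ∧ E y x))
    (hmatch : ∀ a b c, IsMissing E a b → IsMissing E a c → b = c)
    (k : ℕ) (hk : 1 ≤ k) (a b : ℕ → V)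
    (hmiss : ∀ i, 1 ≤ i → i ≤ k → IsMissing E (a i) (b i))
    (hpath : ∀ i, 1 ≤ i → i < k → LosesLab E (a i) (b i) (a (i + 1)) (b (i + 1)))
    (hclose : Loses E s(a k, b k) s(a 1, b 1))
    (hinj : ∀ i j, 1 ≤ i → i ≤ k → 1 ≤ j → j ≤ k → s(a i, b i) = s(a j, b j) → i = j) :
    (Odd k → E (a k) (a 1) ∧ b 1 ∉ Npp E (a k) ∪ Nplus E (a k) ∧
      E (b k) (b 1) ∧ a 1 ∉ Npp E (b k) ∪ Nplus E (b k)) ∧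
    (Even k → E (a k) (b 1) ∧ a 1 ∉ Npp E (a k) ∪ Nplus E (a k) ∧
      E (b k) (a 1) ∧ b 1 ∉ Npp E (b k) ∪ Nplus E (b k)) := by
  have hgen : LosesLab E (a k) (b k) (a 1) (b 1) ∨ LosesLab E (a k) (b k) (b 1) (a 1) := by
    obtain ⟨x1, y1, x2, y2, h1, h2, h⟩ := hclose
    rcases Sym2.eq_iff.1 h1 with ⟨e1, e2⟩ | ⟨e1, e2⟩ <;>
    rcases Sym2.eq_iff.1 h2 with ⟨e3, e4⟩ | ⟨e3, e4⟩ <;> rw [e1, e2, e3, e4]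
    · exact Or.inl h
    · exact Or.inr h
    · exact Or.inr (losesLab_swap h)
    · exact Or.inl (losesLab_swap h)
  have hbad := no_bad_close hloop hmatch k hk
    (fun i => if Odd i then a i else b i) (fun i => if Odd i then b i else a i)
    (by
      intro i h1 h2
      have m := hmiss i h1 h2
      by_cases ho : Odd i
      · simpa [ho] using m
      · have m' : IsMissing E (b i) (a i) := ⟨m.1.symm, m.2.2, m.2.1⟩
        simpa only [ho, if_false] using m')
    (by
      intro i h1 h2
      have m := hpath i h1 h2
      by_cases ho : Odd i
      · have ho' : ¬ Odd (i + 1) := by simpa [Nat.odd_add_one] using ho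
        simpa only [ho, ho', if_true, if_false] using m
      · have ho' : Odd (i + 1) := Nat.odd_add_one.2 ho
        simpa only [ho, ho', if_true, if_false] using losesLab_swap m)
    (by
      have hs : ∀ i, s((if Odd i then a i else b i), (if Odd i then b i else a i))
          = s(a i, b i) := by
        intro i
        by_cases ho : Odd i
        · simp only [ho, if_true]
        · simp only [ho, if_false]; exact Sym2.eq_swap
      intro i j h1 h2 h3 h4 h
      refine hinj i j h1 h2 h3 h4 ?_
      rw [← hs i, ← hs j]
      exact h)
  constructor
  · intro ho
    simp only [ho, odd_one, if_true] at hbad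
    rcases hgen with h | h
    · refine ⟨h.2.2.1, ?_, h.2.2.2.2.1, ?_⟩
      · rw [Set.union_comm]; exact h.2.2.2.1
      · rw [Set.union_comm]; exact h.2.2.2.2.2
    · exact (hbad h).elim
  · intro he
    have ho : ¬ Odd k := Nat.not_odd_iff_even.2 he
    simp only [ho, odd_one, if_true, if_false] at hbad
    rcases hgen with h | h
    · exact (hbad (losesLab_swap h)).elim
    · refine ⟨h.2.2.1, ?_, h.2.2.2.2.1, ?_⟩
      · rw [Set.union_comm]; exact h.2.2.2.1
      · rw [Set.union_comm]; exact h.2.2.2.2.2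
end

section
/- Let D be a finite oriented graph missing a matching and let C = a₁b₁, a₂b₂, …, a_kb_k be a directed cycle of its dependency digraph Δ. In the induced subdigraph D[K(C)] the following hold. If k is odd: N⁺(a₁) = N⁻(b₁) = {a₂, b₃, a₄, b₅, …, a_{k−1}, b_k} (the vertices aᵢ with i even and bᵢ with i odd, i ≥ 3) and N⁻(a₁) = N⁺(b₁) = {b₂, a₃, b₄, a₅, …, b_{k−1}, a_k} (the vertices bᵢ with i even and aᵢ with i odd, i ≥ 3). If k is even: N⁺(a₁) = N⁻(b₁) = {a₂, b₃, a₄, …, b_{k−1}, a_k} (the vertices aᵢ with i even and bᵢ with i odd, i ≥ 3) and N⁻(a₁) = N⁺(b₁) = {b₂, a₃, b₄, …, a_{k−1}, b_k} (the vertices bᵢ with i even and aᵢ with i odd, i ≥ 3). -/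
variable {V : Type*}

theorem IsMissing.symm' {V : Type*} {E : V → V → Prop} {x y : V} (h : IsMissing E x y) :
    IsMissing E y x := ⟨h.1.symm, h.2.2, h.2.1⟩

theorem LosesLab.symm' {V : Type*} {E : V → V → Prop} {x y z w : V}
    (h : LosesLab E x y z w) : LosesLab E y x w z := by
  obtain ⟨h1, h2, h3, h4, h5, h6⟩ := h
  exact ⟨h1.symm', h2.symm', h5, h6, h3, h4⟩

/-- In a graph missing a matching, distinct vertices not matched together are adjacent. -/
theorem adj_of {V : Type*} {E : V → V → Prop}
    (hmatch : ∀ a b c, IsMissing E a b → IsMissing E a c → b = c)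
    {x y v : V} (h : IsMissing E x y) (hx : v ≠ x) (hy : v ≠ y) : E x v ∨ E v x := by
  by_contra hc
  push Not at hc
  exact hy (hmatch x y v h ⟨hx.symm, hc.1, hc.2⟩).symm

theorem loses_back {V : Type*} {E : V → V → Prop}
    (hmatch : ∀ a b c, IsMissing E a b → IsMissing E a c → b = c)
    {x1 y1 x2 y2 : V} (h : LosesLab E x1 y1 x2 y2) (h1 : y2 ≠ x1) (h2 : y2 ≠ y1) :
    E y2 x1 := by
  obtain ⟨m1, m2, e1, n1, e2, n2⟩ := h
  rcases adj_of hmatch m1 h1 h2 with h | h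
  · exact absurd (Or.inl h) n1
  · exact h

theorem loses_out {V : Type*} {E : V → V → Prop} (hloop : ∀ v, ¬ E v v)
    (hmatch : ∀ a b c, IsMissing E a b → IsMissing E a c → b = c)
    {x1 y1 x2 y2 v : V} (h : LosesLab E x1 y1 x2 y2) (h1 : y2 ≠ x1)
    (hv : E x1 v) (hne : v ≠ x2) : E y2 v := by
  obtain ⟨m1, m2, e1, n1, e2, n2⟩ := h
  have n0 : ¬ E x1 y2 := fun h => n1 (Or.inl h)
  have hvy : v ≠ y2 := by rintro rfl; exact n0 hv
  rcases adj_of hmatch m2.symm' hvy hne with h | h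
  · exact h
  · exact absurd (Or.inr ⟨h1, n0, v, hv, h⟩) n1

theorem loses_in {V : Type*} {E : V → V → Prop}
    (hmatch : ∀ a b c, IsMissing E a b → IsMissing E a c → b = c)
    {x1 y1 x2 y2 v : V} (h : LosesLab E x1 y1 x2 y2) (h1 : y2 ≠ x1)
    (hv : E v y2) (hne : v ≠ y1) : E v x1 := by
  obtain ⟨m1, m2, e1, n1, e2, n2⟩ := h
  have n0 : ¬ E x1 y2 := fun h => n1 (Or.inl h)
  have hvx : v ≠ x1 := by rintro rfl; exact n0 hv
  rcases adj_of hmatch m1 hvx hne with h | h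
  · exact absurd (Or.inr ⟨h1, n0, v, h, hv⟩) n1
  · exact h

/-- One half of the structure: `c i → c 1` and `d 1 → c i` for `2 ≤ i ≤ k`. -/
theorem cycle_core {V : Type*} (E : V → V → Prop) (hloop : ∀ v, ¬ E v v)
    (hmatch : ∀ a b c, IsMissing E a b → IsMissing E a c → b = c)
    (k : ℕ) (c d : ℕ → V)
    (hmiss : ∀ i, 1 ≤ i → i ≤ k → IsMissing E (c i) (d i))
    (hpath : ∀ i, 1 ≤ i → i < k → LosesLab E (c i) (d i) (d (i + 1)) (c (i + 1)))
    (hclose : Loses E s(c k, d k) s(c 1, d 1))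
    (hcc : ∀ i j, 1 ≤ i → i ≤ k → 1 ≤ j → j ≤ k → c i = c j → i = j)
    (hdd : ∀ i j, 1 ≤ i → i ≤ k → 1 ≤ j → j ≤ k → d i = d j → i = j)
    (hcd : ∀ i j, 1 ≤ i → i ≤ k → 1 ≤ j → j ≤ k → c i ≠ d j) :
    ∀ i, 2 ≤ i → i ≤ k → E (c i) (c 1) ∧ E (d 1) (c i) := by
  have hf : ∀ i, 2 ≤ i → i ≤ k → E (c i) (c 1) := by
    intro i hi
    induction i, hi using Nat.le_induction with
    | base =>
      intro h
      refine loses_back hmatch (hpath 1 le_rfl (by omega)) ?_ (hcd _ _ (by omega) (by omega) (by omega) (by omega))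
      intro he
      have := hcc _ _ (by omega) (by omega) (by omega) (by omega) he
      omega
    | succ n hn ih =>
      intro h
      refine loses_out hloop hmatch (hpath n (by omega) (by omega)) ?_ (ih (by omega))
        (hcd _ _ (by omega) (by omega) (by omega) (by omega))
      intro he
      have := hcc _ _ (by omega) (by omega) (by omega) (by omega) he
      omega
  intro i hi hik
  refine ⟨hf i hi hik, ?_⟩
  have key : ∀ x2 y2, s(c 1, d 1) = s(x2, y2) → LosesLab E (c k) (d k) x2 y2 →
      E (d 1) (c k) := by
    intro x2 y2 h2 hl
    rcases Sym2.eq_iff.1 h2 with ⟨rfl, rfl⟩ | ⟨rfl, rfl⟩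
    · refine loses_back hmatch hl (hcd _ _ (by omega) (by omega) (by omega) (by omega)).symm ?_
      intro he
      have := hdd _ _ (by omega) (by omega) (by omega) (by omega) he
      omega
    · exact absurd (Or.inl (hf k (by omega) le_rfl)) hl.2.2.2.1
  have htop : E (d 1) (c k) := by
    obtain ⟨x1, y1, x2, y2, h1, h2, hl⟩ := hclose
    rcases Sym2.eq_iff.1 h1 with ⟨rfl, rfl⟩ | ⟨rfl, rfl⟩
    · exact key _ _ h2 hl
    · exact key _ _ (h2.trans Sym2.eq_swap) hl.symm'
  refine Nat.decreasingInduction' (P := fun j => E (d 1) (c j)) ?_ hik htop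
  intro j hj hij h
  refine loses_in hmatch (hpath j (by omega) (by omega)) ?_ h ?_
  · intro he
    have := hcc _ _ (by omega) (by omega) (by omega) (by omega) he
    omega
  · intro he
    have := hdd _ _ (by omega) (by omega) (by omega) (by omega) he
    omega

theorem stmt_11 {V : Type*} [Fintype V]
    (E : V → V → Prop) (hloop : ∀ v, ¬ E v v) (hdigon : ∀ x y, ¬ (E x y ∧ E y x))
    (hmatch : ∀ a b c, IsMissing E a b → IsMissing E a c → b = c)
    (k : ℕ) (hk : 1 ≤ k) (a b : ℕ → V)
    (hmiss : ∀ i, 1 ≤ i → i ≤ k → IsMissing E (a i) (b i))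
    (hpath : ∀ i, 1 ≤ i → i < k → LosesLab E (a i) (b i) (a (i + 1)) (b (i + 1)))
    (hclose : Loses E s(a k, b k) s(a 1, b 1))
    (hinj : ∀ i j, 1 ≤ i → i ≤ k → 1 ≤ j → j ≤ k → s(a i, b i) = s(a j, b j) → i = j)
    (K : Set V) (hK : K = {v | ∃ i, 1 ≤ i ∧ i ≤ k ∧ (v = a i ∨ v = b i)})
    (S1 S2 : Set V)
    (hS1 : S1 = {v | ∃ i, 2 ≤ i ∧ i ≤ k ∧ ((Even i ∧ v = a i) ∨ (Odd i ∧ v = b i))})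
    (hS2 : S2 = {v | ∃ i, 2 ≤ i ∧ i ≤ k ∧ ((Even i ∧ v = b i) ∨ (Odd i ∧ v = a i))}) :
    Nplus (ERestrict E K) (a 1) = S1 ∧ Nminus (ERestrict E K) (b 1) = S1 ∧
    Nminus (ERestrict E K) (a 1) = S2 ∧ Nplus (ERestrict E K) (b 1) = S2 := by
  classical
  have haa : ∀ i j, 1 ≤ i → i ≤ k → 1 ≤ j → j ≤ k → a i = a j → i = j := by
    intro i j h1 h2 h3 h4 h
    have m := hmiss j h3 h4
    rw [← h] at m
    have := hmatch _ _ _ (hmiss i h1 h2) m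
    exact hinj i j h1 h2 h3 h4 (by rw [h, this])
  have hbb : ∀ i j, 1 ≤ i → i ≤ k → 1 ≤ j → j ≤ k → b i = b j → i = j := by
    intro i j h1 h2 h3 h4 h
    have m := (hmiss j h3 h4).symm'
    rw [← h] at m
    have := hmatch _ _ _ (hmiss i h1 h2).symm' m
    exact hinj i j h1 h2 h3 h4 (by rw [h, this])
  have hab : ∀ i j, 1 ≤ i → i ≤ k → 1 ≤ j → j ≤ k → a i ≠ b j := by
    intro i j h1 h2 h3 h4 h
    have m := (hmiss j h3 h4).symm'
    rw [← h] at m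
    have := hmatch _ _ _ (hmiss i h1 h2) m
    have hij := hinj i j h1 h2 h3 h4 (by rw [h, this]; exact Sym2.eq_swap)
    subst hij
    exact (hmiss i h1 h2).1 h
  obtain ⟨c, hc⟩ : ∃ c : ℕ → V, c = fun i => if Even i then a i else b i := ⟨_, rfl⟩
  obtain ⟨d, hd⟩ : ∃ d : ℕ → V, d = fun i => if Even i then b i else a i := ⟨_, rfl⟩
  have hce : ∀ i, Even i → c i = a i ∧ d i = b i := by
    intro i h; simp [hc, hd, h]
  have hco : ∀ i, ¬ Even i → c i = b i ∧ d i = a i := by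
    intro i h; simp [hc, hd, h]
  have hs : ∀ i, s(c i, d i) = s(a i, b i) := by
    intro i
    by_cases h : Even i
    · rw [(hce i h).1, (hce i h).2]
    · rw [(hco i h).1, (hco i h).2]; exact Sym2.eq_swap
  have hm : ∀ i, 1 ≤ i → i ≤ k → IsMissing E (c i) (d i) := by
    intro i h1 h2
    by_cases h : Even i
    · rw [(hce i h).1, (hce i h).2]; exact hmiss i h1 h2
    · rw [(hco i h).1, (hco i h).2]; exact (hmiss i h1 h2).symm'
  have hp : ∀ i, 1 ≤ i → i < k → LosesLab E (c i) (d i) (d (i + 1)) (c (i + 1)) := by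
    intro i h1 h2
    by_cases h : Even i
    · have h' : ¬ Even (i + 1) := by simpa [Nat.even_add_one] using h
      rw [(hce i h).1, (hce i h).2, (hco _ h').1, (hco _ h').2]; exact hpath i h1 h2
    · have h' : Even (i + 1) := by simpa [Nat.even_add_one] using h
      rw [(hco i h).1, (hco i h).2, (hce _ h').1, (hce _ h').2]; exact (hpath i h1 h2).symm'
  have hcl : Loses E s(c k, d k) s(c 1, d 1) := by rw [hs, hs]; exact hclose
  have hcl' : Loses E s(d k, c k) s(d 1, c 1) := by
    rw [Sym2.eq_swap, Sym2.eq_swap (a := d 1)]; exact hcl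
  have hcc : ∀ i j, 1 ≤ i → i ≤ k → 1 ≤ j → j ≤ k → c i = c j → i = j := by
    intro i j h1 h2 h3 h4 h
    have m := hm j h3 h4
    rw [← h] at m
    have := hmatch _ _ _ (hm i h1 h2) m
    exact hinj i j h1 h2 h3 h4 (by rw [← hs, ← hs, h, this])
  have hdd : ∀ i j, 1 ≤ i → i ≤ k → 1 ≤ j → j ≤ k → d i = d j → i = j := by
    intro i j h1 h2 h3 h4 h
    have m := (hm j h3 h4).symm'
    rw [← h] at m
    have := hmatch _ _ _ (hm i h1 h2).symm' m
    exact hinj i j h1 h2 h3 h4 (by rw [← hs, ← hs, h, this])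
  have hcd : ∀ i j, 1 ≤ i → i ≤ k → 1 ≤ j → j ≤ k → c i ≠ d j := by
    intro i j h1 h2 h3 h4 h
    have m := (hm j h3 h4).symm'
    rw [← h] at m
    have := hmatch _ _ _ (hm i h1 h2) m
    have hij := hinj i j h1 h2 h3 h4 (by rw [← hs, ← hs, h, this]; exact Sym2.eq_swap)
    subst hij
    exact (hm i h1 h2).1 h
  have hC := cycle_core E hloop hmatch k c d hm hp hcl hcc hdd hcd
  have hD := cycle_core E hloop hmatch k d c (fun i h1 h2 => (hm i h1 h2).symm')
    (fun i h1 h2 => (hp i h1 h2).symm') hcl' hdd hcc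
    (fun i j h1 h2 h3 h4 h => hcd j i h3 h4 h1 h2 h.symm)
  have hc1 : c 1 = b 1 := (hco 1 (by decide)).1
  have hd1 : d 1 = a 1 := (hco 1 (by decide)).2
  have hKc : ∀ v, v ∈ K ↔ ∃ i, 1 ≤ i ∧ i ≤ k ∧ (v = c i ∨ v = d i) := by
    intro v
    rw [hK]
    refine exists_congr fun i => ?_
    by_cases h : Even i
    · rw [(hce i h).1, (hce i h).2]
    · rw [(hco i h).1, (hco i h).2, or_comm (a := v = b i)]
  have hS1c : ∀ v, v ∈ S1 ↔ ∃ i, 2 ≤ i ∧ i ≤ k ∧ v = c i := by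
    intro v
    rw [hS1]
    refine exists_congr fun i => ?_
    by_cases h : Even i
    · rw [(hce i h).1]; simp [h]
    · rw [(hco i h).1]; simp [h, Nat.not_even_iff_odd.1 h]
  have hS2c : ∀ v, v ∈ S2 ↔ ∃ i, 2 ≤ i ∧ i ≤ k ∧ v = d i := by
    intro v
    rw [hS2]
    refine exists_congr fun i => ?_
    by_cases h : Even i
    · rw [(hce i h).2]; simp [h]
    · rw [(hco i h).2]; simp [h, Nat.not_even_iff_odd.1 h]
  have hK1 : c 1 ∈ K ∧ d 1 ∈ K :=
    ⟨(hKc _).2 ⟨1, le_rfl, hk, Or.inl rfl⟩, (hKc _).2 ⟨1, le_rfl, hk, Or.inr rfl⟩⟩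
  have hKci : ∀ i, 2 ≤ i → i ≤ k → c i ∈ K := fun i h1 h2 =>
    (hKc _).2 ⟨i, by omega, h2, Or.inl rfl⟩
  have hKdi : ∀ i, 2 ≤ i → i ≤ k → d i ∈ K := fun i h1 h2 =>
    (hKc _).2 ⟨i, by omega, h2, Or.inr rfl⟩
  have m1 := hm 1 le_rfl hk
  have hcases : ∀ v ∈ K, v = c 1 ∨ v = d 1 ∨ ∃ i, 2 ≤ i ∧ i ≤ k ∧ (v = c i ∨ v = d i) := by
    intro v hv
    obtain ⟨i, h1, h2, h⟩ := (hKc v).1 hv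
    rcases Nat.lt_or_ge 1 i with h3 | h3
    · exact Or.inr (Or.inr ⟨i, h3, h2, h⟩)
    · have : i = 1 := by omega
      subst this
      tauto
  rw [← hc1, ← hd1]
  refine ⟨?_, ?_, ?_, ?_⟩ <;> ext v <;> constructor
  · rintro ⟨-, hv, he⟩
    rcases hcases v hv with rfl | rfl | ⟨i, h1, h2, rfl | rfl⟩
    · exact absurd he m1.2.2
    · exact absurd he (hloop _)
    · exact (hS1c _).2 ⟨i, h1, h2, rfl⟩
    · exact absurd ⟨he, (hD i h1 h2).1⟩ (hdigon _ _)
  · intro h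
    obtain ⟨i, h1, h2, rfl⟩ := (hS1c v).1 h
    exact ⟨hK1.2, hKci i h1 h2, (hC i h1 h2).2⟩
  · rintro ⟨hv, -, he⟩
    rcases hcases v hv with rfl | rfl | ⟨i, h1, h2, rfl | rfl⟩
    · exact absurd he (hloop _)
    · exact absurd he m1.2.2
    · exact (hS1c _).2 ⟨i, h1, h2, rfl⟩
    · exact absurd ⟨he, (hD i h1 h2).2⟩ (hdigon _ _)
  · intro h
    obtain ⟨i, h1, h2, rfl⟩ := (hS1c v).1 h
    exact ⟨hKci i h1 h2, hK1.1, (hC i h1 h2).1⟩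
  · rintro ⟨hv, -, he⟩
    rcases hcases v hv with rfl | rfl | ⟨i, h1, h2, rfl | rfl⟩
    · exact absurd he m1.2.1
    · exact absurd he (hloop _)
    · exact absurd ⟨he, (hC i h1 h2).2⟩ (hdigon _ _)
    · exact (hS2c _).2 ⟨i, h1, h2, rfl⟩
  · intro h
    obtain ⟨i, h1, h2, rfl⟩ := (hS2c v).1 h
    exact ⟨hKdi i h1 h2, hK1.2, (hD i h1 h2).1⟩
  · rintro ⟨-, hv, he⟩
    rcases hcases v hv with rfl | rfl | ⟨i, h1, h2, rfl | rfl⟩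
    · exact absurd he (hloop _)
    · exact absurd he m1.2.1
    · exact absurd ⟨he, (hC i h1 h2).1⟩ (hdigon _ _)
    · exact (hS2c _).2 ⟨i, h1, h2, rfl⟩
  · intro h
    obtain ⟨i, h1, h2, rfl⟩ := (hS2c v).1 h
    exact ⟨hK1.1, hKdi i h1 h2, (hD i h1 h2).2⟩
end
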